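/- arXiv:1403.5077 — 4 statements merged into one kernel-verified Lean document; each statement's English description precedes it below -/
import Mathlib

section
/- Let W = [[M, b],[bᵀ, c]] be a symmetric (n+1)×(n+1) real positive semidefinite matrix, where M = diag(m₁,…,m_n) is diagonal with m₁ ≥ m₂ ≥ ⋯ ≥ m_n, b ∈ ℝⁿ and c ∈ ℝ, and suppose rank W = l with l ≤ n. Then the rank of M is either l−1 or l, and exactly one of the following holds. CASE 1 (rank M = l−1): m₁ ≥ ⋯ ≥ m_{l−1} > 0, m_l = ⋯ = m_n = 0, b_i = 0 for all l ≤ i ≤ n, and c − Σ_{i=1}^{l−1} b_i²/m_i > 0; in particular σ_l(M) = 0. CASE 2 (rank M = l): m₁ ≥ ⋯ ≥ m_l > 0, m_{l+1} = ⋯ = m_n = 0, b_i = 0 for all l+1 ≤ i ≤ n, and c = Σ_{i=1}^{l} b_i²/m_i; in particular σ_l(M) > 0. -/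
open Matrix

/-- The `k`-th elementary symmetric function of the eigenvalues of a square matrix `W`,
read off from the characteristic polynomial: `det(X•1 - W) = ∑ (-1)^k σ_k X^(n-k)`.
By convention `σ_0 = 1` and `σ_k = 0` for `k` larger than the size. -/
noncomputable def sigmaE {m : Type*} [Fintype m] [DecidableEq m] (k : ℕ)
    (W : Matrix m m ℝ) : ℝ :=
  if k ≤ Fintype.card m then (-1 : ℝ) ^ k * W.charpoly.coeff (Fintype.card m - k) else 0

open Polynomial in
/-- The characteristic polynomial of `diagonal d` splits off one factor `X` per zero entry. -/
lemma charpoly_diagonal_eq_X_pow_mul {ι : Type*} [Fintype ι] [DecidableEq ι] (d : ι → ℝ) :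
    (diagonal d).charpoly =
      X ^ (Fintype.card ι - (Finset.univ.filter fun i => d i ≠ 0).card) *
        ∏ i ∈ Finset.univ.filter (fun i => d i ≠ 0), (X - C (d i)) := by
  have hcard : (Finset.univ.filter fun i => ¬ d i ≠ 0).card =
      Fintype.card ι - (Finset.univ.filter fun i => d i ≠ 0).card := by
    rw [← Finset.card_univ, ← Finset.card_filter_add_card_filter_not (s := Finset.univ)
      (fun i => d i ≠ 0), Nat.add_sub_cancel_left]
  rw [charpoly_diagonal, ← Finset.prod_filter_mul_prod_filter_not _ (fun i => d i ≠ 0), mul_comm,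
    ← hcard, ← Finset.prod_const]
  congr 1
  refine Finset.prod_congr rfl fun i hi => ?_
  have hi0 : d i = 0 := by simpa using hi
  simp [hi0]

/-- `σ_k` of a diagonal matrix vanishes when fewer than `k` entries are nonzero. -/
lemma sigmaE_diagonal_of_card_lt {ι : Type*} [Fintype ι] [DecidableEq ι] (d : ι → ℝ) {k : ℕ}
    (hk : (Finset.univ.filter fun i => d i ≠ 0).card < k) : sigmaE k (diagonal d) = 0 := by
  unfold sigmaE
  split_ifs with hkn
  · rw [charpoly_diagonal_eq_X_pow_mul, Polynomial.coeff_X_pow_mul', if_neg (by omega), mul_zero]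
  · rfl

/-- When exactly `k` entries of a diagonal matrix are nonzero, `σ_k` is their product. -/
lemma sigmaE_diagonal_card {ι : Type*} [Fintype ι] [DecidableEq ι] (d : ι → ℝ) :
    sigmaE (Finset.univ.filter fun i => d i ≠ 0).card (diagonal d) =
      ∏ i ∈ Finset.univ.filter (fun i => d i ≠ 0), d i := by
  unfold sigmaE
  rw [if_pos (Finset.card_le_univ _), charpoly_diagonal_eq_X_pow_mul,
    Polynomial.coeff_X_pow_mul', if_pos le_rfl, Nat.sub_self, Polynomial.coeff_zero_prod,
    ← Finset.prod_const, ← Finset.prod_mul_distrib]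
  simp

/-- A finite initial segment of `Fin n` consists of the indices below its cardinality. -/
lemma Fin.mem_iff_lt_card_of_isLowerSet {n : ℕ} {s : Finset (Fin n)}
    (hs : ∀ i j : Fin n, i ≤ j → j ∈ s → i ∈ s) (i : Fin n) : i ∈ s ↔ (i : ℕ) < s.card := by
  constructor
  · intro hi
    have hsub : Finset.Iic i ⊆ s := fun j hj => hs j i (Finset.mem_Iic.mp hj) hi
    have := Finset.card_le_card hsub
    rw [Fin.card_Iic] at this
    omega
  · intro hlt
    by_contra hi
    have hsub : s ⊆ Finset.Iio i := fun j hj =>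
      Finset.mem_Iio.mpr (lt_of_not_ge fun hij => hi (hs i j hij hj))
    have := Finset.card_le_card hsub
    rw [Fin.card_Iio] at this
    omega

section BorderedDiagonal

variable {ι : Type*} [Fintype ι] [DecidableEq ι] {m b : ι → ℝ} {c : ℝ}

/-- The bordered diagonal matrix `[[diag m, b], [bᵀ, c]]`. -/
abbrev borderedDiagonal (m b : ι → ℝ) (c : ℝ) : Matrix (ι ⊕ Unit) (ι ⊕ Unit) ℝ :=
  Matrix.fromBlocks (Matrix.diagonal m) (Matrix.of fun i (_ : Unit) => b i)
    (Matrix.of fun (_ : Unit) j => b j) (Matrix.of fun (_ : Unit) (_ : Unit) => c)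

lemma borderedDiagonal_quadratic_nonneg (h : (borderedDiagonal m b c).PosSemidef) (x : ι → ℝ) :
    0 ≤ ∑ i, (m i * x i ^ 2 + 2 * (b i * x i)) + c := by
  have hx := h.dotProduct_mulVec_nonneg (Sum.elim x fun _ => 1)
  have e : star (Sum.elim x fun _ => 1) ⬝ᵥ (borderedDiagonal m b c *ᵥ Sum.elim x fun _ => 1) =
      ∑ i, x i * (m i * x i + b i) + (∑ i, b i * x i + c) := by
    simp [dotProduct, mulVec, diagonal_apply]
  rw [e, ← add_assoc, ← Finset.sum_add_distrib] at hx
  refine hx.trans_eq (congrArg (· + c) (Finset.sum_congr rfl fun i _ => ?_))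
  ring

lemma borderedDiagonal_border_eq_zero (h : (borderedDiagonal m b c).PosSemidef) {i : ι}
    (hi : m i = 0) : b i = 0 := by
  have key : ∀ t : ℝ, 0 ≤ 2 * (b i * t) + c := fun t => by
    have := borderedDiagonal_quadratic_nonneg h (Pi.single i t)
    rwa [Finset.sum_eq_single i (fun j _ hj => by simp [hj]) (by simp), Pi.single_eq_same, hi,
      zero_mul, zero_add] at this
  by_contra hb
  have := key (-(c + 1) / (2 * b i))
  have e : 2 * (b i * (-(c + 1) / (2 * b i))) = -(c + 1) := by field_simp
  linarith

/-- The Schur complement of a positive semidefinite bordered diagonal matrix is nonnegative. -/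
lemma borderedDiagonal_schur_nonneg (h : (borderedDiagonal m b c).PosSemidef) :
    0 ≤ c - ∑ i, b i ^ 2 / m i := by
  have hx := borderedDiagonal_quadratic_nonneg h fun i => -(b i / m i)
  have e : ∑ i, (m i * (-(b i / m i)) ^ 2 + 2 * (b i * -(b i / m i))) = -∑ i, b i ^ 2 / m i := by
    rw [← Finset.sum_neg_distrib]
    refine Finset.sum_congr rfl fun i _ => ?_
    rcases eq_or_ne (m i) 0 with hi | hi
    · simp [hi]
    · field_simp
      ring
  rw [e] at hx
  linarith

/-- Block elimination: a bordered diagonal matrix is congruent to a diagonal one. -/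
lemma borderedDiagonal_eq_mul (hb : ∀ i, m i = 0 → b i = 0) :
    borderedDiagonal m b c =
      fromBlocks 1 0 (of fun (_ : Unit) j => b j / m j) 1 *
        diagonal (Sum.elim m fun _ => c - ∑ i, b i ^ 2 / m i) *
        (fromBlocks 1 (of fun i (_ : Unit) => b i / m i) 0 1) := by
  have hmul : ∀ i, b i / m i * m i = b i := fun i => by
    rcases eq_or_ne (m i) 0 with hi | hi
    · simp [hi, hb i hi]
    · field_simp
  rw [← fromBlocks_diagonal, fromBlocks_multiply, fromBlocks_multiply, fromBlocks_inj]
  refine ⟨by simp, ?_, ?_, ?_⟩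
  · ext i j
    simp [mul_comm (m i), hmul]
  · ext i j
    simp [hmul]
  · ext i j
    simp [mul_apply, hmul, pow_two, mul_div_assoc, diagonal_apply]

/-- Rank additivity for the Schur complement of a bordered diagonal matrix. -/
lemma rank_borderedDiagonal (hb : ∀ i, m i = 0 → b i = 0) :
    (borderedDiagonal m b c).rank =
      (diagonal m).rank + if c - ∑ i, b i ^ 2 / m i = 0 then 0 else 1 := by
  rw [borderedDiagonal_eq_mul hb, rank_mul_eq_left_of_isUnit_det _ _ (by simp),
    rank_mul_eq_right_of_isUnit_det _ _ (by simp), rank_diagonal, rank_diagonal,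
    Fintype.card_congr (Equiv.subtypeSum), Fintype.card_sum]
  congr 1
  split_ifs with hs <;> simp [hs, Fintype.card_subtype]

end BorderedDiagonal

/-- the dichotomy (Lemma 2.4) for a positive semidefinite bordered
diagonal matrix `W = [[M, b],[bᵀ, c]]` of rank `l ≤ n`, with
`M = diag(m₁ ≥ ⋯ ≥ m_n)`.  (Indices here are `0`-based: the `1`-based index of
`i : Fin n` is `(i : ℕ) + 1`.) -/
theorem stmt3 {n : ℕ} (l : ℕ) (hl : l ≤ n) (m b : Fin n → ℝ) (c : ℝ)
    (hsort : ∀ i j : Fin n, i ≤ j → m j ≤ m i)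
    (hpsd : (Matrix.fromBlocks (Matrix.diagonal m) (Matrix.of fun i (_ : Unit) => b i)
      (Matrix.of fun (_ : Unit) j => b j) (Matrix.of fun (_ : Unit) (_ : Unit) => c)).PosSemidef)
    (hrank : (Matrix.fromBlocks (Matrix.diagonal m) (Matrix.of fun i (_ : Unit) => b i)
      (Matrix.of fun (_ : Unit) j => b j) (Matrix.of fun (_ : Unit) (_ : Unit) => c)).rank = l) :
    ((Matrix.diagonal m).rank = l - 1 ∨ (Matrix.diagonal m).rank = l) ∧
    Xor'
      -- CASE 1: rank M = l − 1
      ((Matrix.diagonal m).rank = l - 1 ∧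
        (∀ i : Fin n, (i : ℕ) + 1 < l → 0 < m i) ∧
        (∀ i : Fin n, l ≤ (i : ℕ) + 1 → m i = 0) ∧
        (∀ i : Fin n, l ≤ (i : ℕ) + 1 → b i = 0) ∧
        (0 < c - ∑ i ∈ Finset.univ.filter (fun i : Fin n => (i : ℕ) + 1 < l),
          b i ^ 2 / m i) ∧
        sigmaE l (Matrix.diagonal m) = 0)
      -- CASE 2: rank M = l
      ((Matrix.diagonal m).rank = l ∧
        (∀ i : Fin n, (i : ℕ) < l → 0 < m i) ∧
        (∀ i : Fin n, l ≤ (i : ℕ) → m i = 0) ∧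
        (∀ i : Fin n, l ≤ (i : ℕ) → b i = 0) ∧
        (c = ∑ i ∈ Finset.univ.filter (fun i : Fin n => (i : ℕ) < l),
          b i ^ 2 / m i) ∧
        0 < sigmaE l (Matrix.diagonal m)) := by
  classical
  have hb : ∀ i, m i = 0 → b i = 0 := fun i => borderedDiagonal_border_eq_zero hpsd
  have hnn : ∀ i, 0 ≤ m i := fun i => by simpa using hpsd.diag_nonneg (i := Sum.inl i)
  have hs := borderedDiagonal_schur_nonneg hpsd
  have hr : (diagonal m).rank = (Finset.univ.filter fun i => m i ≠ 0).card := by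
    rw [rank_diagonal, Fintype.card_subtype]
  have hrl : (diagonal m).rank + (if c - ∑ i, b i ^ 2 / m i = 0 then 0 else 1) = l :=
    (rank_borderedDiagonal hb).symm.trans hrank
  have hmem : ∀ i : Fin n, m i ≠ 0 ↔ (i : ℕ) < (diagonal m).rank := fun i => by
    rw [hr, ← Fin.mem_iff_lt_card_of_isLowerSet, Finset.mem_filter_univ]
    intro i j hij hj
    rw [Finset.mem_filter_univ] at hj ⊢
    exact (((hnn j).lt_of_ne' hj).trans_le (hsort i j hij)).ne'
  have hpos : ∀ i : Fin n, (i : ℕ) < (diagonal m).rank → 0 < m i := fun i hi =>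
    (hnn i).lt_of_ne' ((hmem i).mpr hi)
  have hzero : ∀ i : Fin n, (diagonal m).rank ≤ (i : ℕ) → m i = 0 := fun i hi => by
    by_contra h
    exact absurd ((hmem i).mp h) (by omega)
  have hsum : ∑ i ∈ Finset.univ.filter (fun i : Fin n => (i : ℕ) < (diagonal m).rank),
      b i ^ 2 / m i = ∑ i, b i ^ 2 / m i := by
    refine Finset.sum_subset (Finset.subset_univ _) fun i _ hi => ?_
    rw [hzero i (by simpa using hi), div_zero]
  have hsigma : 0 < sigmaE (diagonal m).rank (diagonal m) := by
    rw [hr, sigmaE_diagonal_card]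
    exact Finset.prod_pos fun i hi => (hnn i).lt_of_ne' (by simpa using hi)
  split_ifs at hrl with h0
  · obtain rfl : (diagonal m).rank = l := hrl
    refine ⟨Or.inr rfl, Or.inr ⟨⟨rfl, hpos, hzero, fun i hi => hb i (hzero i hi), ?_, hsigma⟩, ?_⟩⟩
    · rw [hsum]
      linarith
    · rintro ⟨-, -, -, -, -, h⟩
      exact hsigma.ne' h
  · have hrl' : (diagonal m).rank = l - 1 := by omega
    have hlt : ∀ i : ℕ, i + 1 < l ↔ i < (diagonal m).rank := fun i => by omega
    have hle : ∀ i : ℕ, l ≤ i + 1 ↔ (diagonal m).rank ≤ i := fun i => by omega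
    refine ⟨Or.inl hrl', Or.inl ⟨⟨hrl', ?_, ?_, ?_, ?_, ?_⟩, ?_⟩⟩
    · exact fun i hi => hpos i ((hlt i).mp hi)
    · exact fun i hi => hzero i ((hle i).mp hi)
    · exact fun i hi => hb i (hzero i ((hle i).mp hi))
    · simp only [hlt, hsum]
      exact hs.lt_of_ne' h0
    · exact sigmaE_diagonal_of_card_lt m (by omega)
    · rintro ⟨h, -⟩
      omega
end

section
/- Let A = diag(a₁,…,a_n) be a diagonal n×n real matrix, b ∈ ℝⁿ, c ∈ ℝ, and let W = [[A, b],[bᵀ, c]] be the corresponding symmetric (n+1)×(n+1) matrix. Then for every integer k ≥ 1, σ_k(W) = σ_k(A) + c σ_{k−1}(A) − Σ_{i=1}^n b_i² σ_{k−2}(A|i). -/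
open Matrix

/-- Integer-indexed version, with `σ_k = 0` for `k < 0`. -/
noncomputable def sigmaEZ {m : Type*} [Fintype m] [DecidableEq m] (k : ℤ)
    (W : Matrix m m ℝ) : ℝ :=
  if 0 ≤ k then sigmaE k.toNat W else 0

/-- `σ_k(W|i)`: `σ_k` of the matrix obtained from `W` by deleting the `i`-th row and
column (integer-indexed). -/
noncomputable def sigmaDelZ {n : ℕ} (k : ℤ) (W : Matrix (Fin n) (Fin n) ℝ) (i : Fin n) : ℝ :=
  sigmaEZ k (W.submatrix (fun a : {j : Fin n // j ≠ i} => (a : Fin n))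
    (fun a : {j : Fin n // j ≠ i} => (a : Fin n)))

/-- Determinant of a bordered diagonal matrix over a field, with nonzero diagonal. -/
theorem det_bordered_diagonal_of_ne_zero {ι K : Type*} [Fintype ι] [DecidableEq ι] [Field K]
    (d u v : ι → K) (e : K) (hd : ∀ i, d i ≠ 0) :
    (Matrix.fromBlocks (Matrix.diagonal d) (Matrix.of fun i (_ : Unit) => u i)
        (Matrix.of fun (_ : Unit) j => v j) (Matrix.of fun (_ : Unit) (_ : Unit) => e)).det =
      e * ∏ i, d i - ∑ i, v i * u i * ∏ j : {j // j ≠ i}, d j := by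
  have hdet : IsUnit (Matrix.diagonal d).det := by
    rw [Matrix.det_diagonal]
    exact (Finset.prod_ne_zero_iff.mpr fun i _ => hd i).isUnit
  let := Matrix.invertibleOfIsUnitDet _ hdet
  have hinv : ⅟(Matrix.diagonal d) = Matrix.diagonal fun i => (d i)⁻¹ := by
    apply invOf_eq_right_inv
    rw [Matrix.diagonal_mul_diagonal, ← Matrix.diagonal_one]
    congr 1
    ext i
    exact mul_inv_cancel₀ (hd i)
  rw [Matrix.det_fromBlocks₁₁, hinv, Matrix.det_diagonal, Matrix.det_unique,
    Matrix.sub_apply, mul_sub, Matrix.mul_apply, Finset.mul_sum]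
  simp only [Matrix.mul_diagonal, Matrix.of_apply]
  congr 1
  · exact mul_comm _ _
  · refine Finset.sum_congr rfl fun i _ => ?_
    have hprod : ∏ j, d j = d i * ∏ j : {j // j ≠ i}, d j :=
      Fintype.prod_eq_mul_prod_subtype_ne d i
    rw [hprod]
    field_simp [hd i]

open Polynomial in
/-- Characteristic polynomial of a diagonal matrix bordered by a row and a column. -/
theorem charpoly_bordered_diagonal {ι R : Type*} [Fintype ι] [DecidableEq ι] [CommRing R]
    [IsDomain R] (a u v : ι → R) (c : R) :
    (Matrix.fromBlocks (Matrix.diagonal a) (Matrix.of fun i (_ : Unit) => u i)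
        (Matrix.of fun (_ : Unit) j => v j) (Matrix.of fun (_ : Unit) (_ : Unit) => c)).charpoly =
      (X - C c) * (Matrix.diagonal a).charpoly - ∑ i, C (v i * u i) *
        ((Matrix.diagonal a).submatrix (fun j : {j // j ≠ i} => (j : ι))
          (fun j : {j // j ≠ i} => (j : ι))).charpoly := by
  have hsub (i : ι) : (Matrix.diagonal a).submatrix (fun j : {j // j ≠ i} => (j : ι))
      (fun j : {j // j ≠ i} => (j : ι)) = Matrix.diagonal fun j : {j // j ≠ i} => a j :=
    Matrix.submatrix_diagonal a _ Subtype.val_injective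
  simp only [hsub, Matrix.charpoly_diagonal]
  let φ := algebraMap R[X] (FractionRing R[X])
  have hφ : Function.Injective φ := IsFractionRing.injective _ _
  apply hφ
  have key := det_bordered_diagonal_of_ne_zero (fun i => φ (X - C (a i))) (fun i => φ (-C (u i)))
    (fun i => φ (-C (v i))) (φ (X - C c))
    (fun i => (map_ne_zero_iff φ hφ).mpr (X_sub_C_ne_zero _))
  rw [Matrix.charpoly, RingHom.map_det]
  have hmat : φ.mapMatrix (Matrix.fromBlocks (Matrix.diagonal a)
      (Matrix.of fun i (_ : Unit) => u i) (Matrix.of fun (_ : Unit) j => v j)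
      (Matrix.of fun (_ : Unit) (_ : Unit) => c)).charmatrix =
      Matrix.fromBlocks (Matrix.diagonal fun i => φ (X - C (a i)))
        (Matrix.of fun i (_ : Unit) => φ (-C (u i))) (Matrix.of fun (_ : Unit) j => φ (-C (v j)))
        (Matrix.of fun (_ : Unit) (_ : Unit) => φ (X - C c)) := by
    ext (i | i) (j | j)
    · by_cases h : i = j
      · subst h; simp
      · simp [h]
    all_goals simp
  rw [hmat, key]
  simp only [map_sub, map_sum, map_mul, map_prod, map_neg, neg_mul_neg]

theorem sigmaDelZ_sub_two_eq_coeff {n : ℕ} (W : Matrix (Fin n) (Fin n) ℝ) (i : Fin n) {k : ℕ}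
    (hk : 1 ≤ k) (hkn : k ≤ n + 1) :
    sigmaDelZ ((k : ℤ) - 2) W i = (-1 : ℝ) ^ k * (W.submatrix
      (fun j : {j : Fin n // j ≠ i} => (j : Fin n))
      (fun j : {j : Fin n // j ≠ i} => (j : Fin n))).charpoly.coeff (n + 1 - k) := by
  have hcard : Fintype.card {j : Fin n // j ≠ i} = n - 1 := by simp
  have hn : 0 < n := i.pos
  rw [sigmaDelZ, sigmaEZ]
  split_ifs with h2
  · obtain ⟨l, rfl⟩ : ∃ l, k = l + 2 := ⟨k - 2, by omega⟩
    have hl : (((l + 2 : ℕ) : ℤ) - 2).toNat = l := by omega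
    rw [sigmaE, hl, hcard, if_pos (by omega), show n + 1 - (l + 2) = n - 1 - l by omega]
    ring
  · rw [Polynomial.coeff_eq_zero_of_natDegree_lt, mul_zero]
    rw [Matrix.charpoly_natDegree_eq_dim, hcard]
    omega

theorem sigmaDelZ_eq_zero {n : ℕ} (W : Matrix (Fin n) (Fin n) ℝ) (i : Fin n) {k : ℤ}
    (hk : (n : ℤ) ≤ k) : sigmaDelZ k W i = 0 := by
  have hcard : Fintype.card {j : Fin n // j ≠ i} = n - 1 := by simp
  have hn : 0 < n := i.pos
  rw [sigmaDelZ, sigmaEZ, if_pos (by omega), sigmaE, hcard, if_neg (by omega)]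

/-- for a bordered diagonal matrix `W = [[A, b],[bᵀ, c]]` with
`A = diag(a)`, one has `σ_k(W) = σ_k(A) + c σ_{k−1}(A) − Σᵢ bᵢ² σ_{k−2}(A|i)` for all
`k ≥ 1`. -/
theorem stmt11 {n : ℕ} (a b : Fin n → ℝ) (c : ℝ) (k : ℕ) (hk : 1 ≤ k) :
    sigmaE k (Matrix.fromBlocks (Matrix.diagonal a) (Matrix.of fun i (_ : Unit) => b i)
        (Matrix.of fun (_ : Unit) j => b j) (Matrix.of fun (_ : Unit) (_ : Unit) => c)) =
      sigmaE k (Matrix.diagonal a) + c * sigmaE (k - 1) (Matrix.diagonal a) -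
        ∑ i : Fin n, b i ^ 2 * sigmaDelZ ((k : ℤ) - 2) (Matrix.diagonal a) i := by
  by_cases hkn : k ≤ n + 1
  · have hsum : ∑ i : Fin n, b i ^ 2 * sigmaDelZ ((k : ℤ) - 2) (Matrix.diagonal a) i =
        (-1 : ℝ) ^ k * (∑ i : Fin n, Polynomial.C (b i * b i) * ((Matrix.diagonal a).submatrix
          (fun j : {j : Fin n // j ≠ i} => (j : Fin n))
          (fun j : {j : Fin n // j ≠ i} => (j : Fin n))).charpoly).coeff (n + 1 - k) := by
      rw [Polynomial.finsetSum_coeff, Finset.mul_sum]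
      refine Finset.sum_congr rfl fun i _ => ?_
      rw [sigmaDelZ_sub_two_eq_coeff _ _ hk hkn, Polynomial.coeff_C_mul]
      ring
    rw [hsum]
    obtain ⟨l, rfl⟩ : ∃ l, k = l + 1 := ⟨k - 1, by omega⟩
    simp only [sigmaE, Fintype.card_sum, Fintype.card_fin, Fintype.card_unit, if_pos hkn,
      charpoly_bordered_diagonal, Polynomial.coeff_sub, sub_mul, Polynomial.coeff_C_mul,
      Nat.add_sub_cancel, Nat.add_sub_add_right, if_pos (Nat.le_of_succ_le_succ hkn)]
    split_ifs with h
    · rw [show n - l = n - (l + 1) + 1 by omega, Polynomial.coeff_X_mul]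
      ring
    · rw [show n - l = 0 by omega, Polynomial.coeff_X_mul_zero]
      ring
  · rw [Finset.sum_eq_zero fun i _ => by rw [sigmaDelZ_eq_zero _ _ (by omega), mul_zero]]
    simp only [sigmaE, Fintype.card_sum, Fintype.card_fin, Fintype.card_unit, if_neg hkn]
    rw [if_neg (by omega), if_neg (by omega)]
    ring
end

section
/- Fix integers n ≥ 1 and 1 ≤ k ≤ n. The map A ↦ (σ_k(A⁻¹))^{1/k} is convex on the set of symmetric positive definite n×n real matrices. Consequently, the Hessian operator σ_k^{1/k} satisfies the structural condition (1.7) for convex admissible solutions. -/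
open Matrix

/-- `σ_k` is the sum of the `k × k` principal minors. -/
lemma sigmaE_eq_sum_minors {m : Type*} [Fintype m] [DecidableEq m] {k : ℕ}
    (hk : k ≤ Fintype.card m) (W : Matrix m m ℝ) :
    sigmaE k W = ∑ s ∈ Finset.univ.powersetCard k,
      (W.submatrix (Subtype.val : s → m) (Subtype.val : s → m)).det := by
  rw [sigmaE, if_pos hk, charpoly_coeff_eq_sum_minors W k hk, ← mul_assoc, ← mul_pow]
  simp

lemma sigmaE_mul_comm {m : Type*} [Fintype m] [DecidableEq m] (k : ℕ) (A B : Matrix m m ℝ) :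
    sigmaE k (A * B) = sigmaE k (B * A) := by
  simp only [sigmaE, charpoly_mul_comm A B]

lemma sigmaE_diagonal_mul {m : Type*} [Fintype m] [DecidableEq m] {k : ℕ}
    (hk : k ≤ Fintype.card m) (e : m → ℝ) (G : Matrix m m ℝ) :
    sigmaE k (diagonal e * G) = ∑ s ∈ Finset.univ.powersetCard k,
      (G.submatrix (Subtype.val : s → m) (Subtype.val : s → m)).det * ∏ i ∈ s, e i := by
  rw [sigmaE_eq_sum_minors hk]
  refine Finset.sum_congr rfl fun s _ => ?_
  have h : (diagonal e * G).submatrix (Subtype.val : s → m) (Subtype.val : s → m) =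
      diagonal (fun i : s => e i) *
        G.submatrix (Subtype.val : s → m) (Subtype.val : s → m) := by
    ext i j
    simp
  rw [h, det_mul, det_diagonal, mul_comm, Finset.prod_coe_sort s e]

/-- Two positive definite real matrices are simultaneously diagonalized by a congruence which
carries the first one to the identity. -/
lemma Matrix.PosDef.exists_simultaneous_diagonalization {m : Type*} [Fintype m] [DecidableEq m]
    {A B : Matrix m m ℝ} (hA : A.PosDef) (hB : B.PosDef) :
    ∃ (P : Matrix m m ℝ) (d : m → ℝ), IsUnit P ∧ (∀ i, 0 < d i) ∧
      A = P * Pᴴ ∧ B = P * diagonal d * Pᴴ := by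
  obtain ⟨Y, hY, rfl⟩ : ∃ Y : Matrix m m ℝ, IsUnit Y ∧ A = Yᴴ * Y := by
    open scoped MatrixOrder in
    obtain ⟨Y, hY⟩ := CStarAlgebra.nonneg_iff_eq_star_mul_self.mp hA.posSemidef.nonneg
    refine ⟨Y, ?_, hY⟩
    have h := hA.isUnit
    rw [hY] at h
    exact isUnit_of_mul_isUnit_right h
  have hYdet : IsUnit Y.det := (isUnit_iff_isUnit_det Y).mp hY
  have hN : (Y⁻¹ᴴ * B * Y⁻¹).PosDef :=
    (IsUnit.posDef_star_left_conjugate_iff ((isUnit_nonsing_inv_iff).mpr hY)).mpr hB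
  have hspec := hN.isHermitian.spectral_theorem
  rw [Unitary.conjStarAlgAut_apply] at hspec
  set U : Matrix m m ℝ := (hN.isHermitian.eigenvectorUnitary : Matrix m m ℝ)
  have hUU : U * Uᴴ = 1 := Unitary.coe_mul_star_self hN.isHermitian.eigenvectorUnitary
  refine ⟨Yᴴ * U, hN.isHermitian.eigenvalues, ?_, hN.eigenvalues_pos, ?_, ?_⟩
  · exact hY.star.mul (IsUnit.of_mul_eq_one _ hUU)
  · rw [conjTranspose_mul, conjTranspose_conjTranspose, Matrix.mul_assoc, ← Matrix.mul_assoc U,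
      hUU, Matrix.one_mul]
  · have hB' : B = Yᴴ * (Y⁻¹ᴴ * B * Y⁻¹) * Y := by
      have h1 : Yᴴ * Y⁻¹ᴴ = 1 := by
        rw [← conjTranspose_mul, nonsing_inv_mul Y hYdet, conjTranspose_one]
      calc B = (Yᴴ * Y⁻¹ᴴ) * B * (Y⁻¹ * Y) := by rw [h1, nonsing_inv_mul Y hYdet]; simp
        _ = _ := by simp only [Matrix.mul_assoc]
    have hspec' : Y⁻¹ᴴ * B * Y⁻¹ = U * diagonal hN.isHermitian.eigenvalues * Uᴴ := hspec
    rw [hspec'] at hB'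
    rw [conjTranspose_mul, conjTranspose_conjTranspose]
    simpa only [Matrix.mul_assoc] using hB'

lemma sigmaE_inv_congruence {m : Type*} [Fintype m] [DecidableEq m] (k : ℕ)
    (P : Matrix m m ℝ) {e : m → ℝ} (he : ∀ i, e i ≠ 0) :
    sigmaE k (P * diagonal e * Pᴴ)⁻¹ =
      sigmaE k (diagonal (fun i => (e i)⁻¹) * (P⁻¹ * P⁻¹ᴴ)) := by
  have hinv : (diagonal e)⁻¹ = diagonal (fun i => (e i)⁻¹) := by
    refine inv_eq_right_inv ?_
    simp [diagonal_mul_diagonal, he]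
  rw [Matrix.mul_inv_rev, Matrix.mul_inv_rev, hinv, sigmaE_mul_comm, ← conjTranspose_nonsing_inv,
    Matrix.mul_assoc]

/-- The scalar estimate behind the convexity: along a segment, products of reciprocals of
positive affine functions have convex roots of every order. -/
lemma prod_inv_affine_rpow_le {ι : Type*} (s : Finset ι) {d : ι → ℝ} (hd : ∀ i, 0 < d i)
    {a b r : ℝ} (ha : 0 ≤ a) (hb : 0 ≤ b) (hab : a + b = 1) (hr : 0 ≤ r) :
    (∏ i ∈ s, (a + b * d i)⁻¹) ^ r ≤ a + b * (∏ i ∈ s, (d i)⁻¹) ^ r := by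
  have hprod : ∏ i ∈ s, (a + b * d i)⁻¹ ≤ (∏ i ∈ s, (d i)⁻¹) ^ b := by
    rw [← Real.finsetProd_rpow _ _ fun i _ => (inv_pos.mpr (hd i)).le]
    refine Finset.prod_le_prod (fun i _ => ?_) fun i _ => ?_
    · have := hd i
      positivity
    · have h := Real.geom_mean_le_arith_mean2_weighted ha hb zero_le_one (hd i).le hab
      rw [Real.one_rpow, one_mul, mul_one] at h
      rw [Real.inv_rpow (hd i).le]
      exact inv_anti₀ (Real.rpow_pos_of_pos (hd i) b) h
  have hx : 0 ≤ ∏ i ∈ s, (d i)⁻¹ := Finset.prod_nonneg fun i _ => (inv_pos.mpr (hd i)).le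
  have h0 : 0 ≤ ∏ i ∈ s, (a + b * d i)⁻¹ := Finset.prod_nonneg fun i _ => by
    have := hd i
    positivity
  calc (∏ i ∈ s, (a + b * d i)⁻¹) ^ r ≤ ((∏ i ∈ s, (d i)⁻¹) ^ b) ^ r :=
        Real.rpow_le_rpow h0 hprod hr
    _ = 1 ^ a * ((∏ i ∈ s, (d i)⁻¹) ^ r) ^ b := by
        rw [Real.one_rpow, one_mul, ← Real.rpow_mul hx, ← Real.rpow_mul hx, mul_comm]
    _ ≤ a * 1 + b * (∏ i ∈ s, (d i)⁻¹) ^ r :=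
        Real.geom_mean_le_arith_mean2_weighted ha hb zero_le_one (Real.rpow_nonneg hx r) hab
    _ = _ := by rw [mul_one]

/-- Weighted `ℓ^p` sums preserve a convexity inequality between `p`-th roots. -/
lemma rpow_sum_le_of_rpow_le {ι : Type*} (S : Finset ι) {w x y : ι → ℝ} {a b p : ℝ}
    (hp : 1 ≤ p) (ha : 0 ≤ a) (hb : 0 ≤ b) (hw : ∀ i ∈ S, 0 ≤ w i) (hx : ∀ i ∈ S, 0 ≤ x i)
    (hy : ∀ i ∈ S, 0 ≤ y i) (h : ∀ i ∈ S, y i ^ (1 / p) ≤ a + b * x i ^ (1 / p)) :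
    (∑ i ∈ S, w i * y i) ^ (1 / p) ≤
      a * (∑ i ∈ S, w i) ^ (1 / p) + b * (∑ i ∈ S, w i * x i) ^ (1 / p) := by
  have hp0 : p ≠ 0 := by linarith
  have hr : 0 ≤ 1 / p := by positivity
  have root : ∀ {c : ℝ}, 0 ≤ c → (c ^ (1 / p)) ^ p = c := fun hc => by
    rw [← Real.rpow_mul hc, one_div_mul_cancel hp0, Real.rpow_one]
  have root' : ∀ {c : ℝ}, 0 ≤ c → (c ^ p) ^ (1 / p) = c := fun hc => by
    rw [← Real.rpow_mul hc, mul_one_div_cancel hp0, Real.rpow_one]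
  have scale : ∀ {c : ℝ} {z : ι → ℝ}, 0 ≤ c → (∀ i ∈ S, 0 ≤ z i) →
      (∑ i ∈ S, (c * z i ^ (1 / p)) ^ p) ^ (1 / p) = c * (∑ i ∈ S, z i) ^ (1 / p) := by
    intro c z hc hz
    have : ∑ i ∈ S, (c * z i ^ (1 / p)) ^ p = c ^ p * ∑ i ∈ S, z i := by
      rw [Finset.mul_sum]
      refine Finset.sum_congr rfl fun i hi => ?_
      rw [Real.mul_rpow hc (Real.rpow_nonneg (hz i hi) _), root (hz i hi)]
    rw [this, Real.mul_rpow (Real.rpow_nonneg hc p) (Finset.sum_nonneg hz), root' hc]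
  have hwx : ∀ i ∈ S, 0 ≤ w i * x i := fun i hi => mul_nonneg (hw i hi) (hx i hi)
  have hwy : ∀ i ∈ S, 0 ≤ w i * y i := fun i hi => mul_nonneg (hw i hi) (hy i hi)
  calc (∑ i ∈ S, w i * y i) ^ (1 / p)
      ≤ (∑ i ∈ S, (a * w i ^ (1 / p) + b * (w i * x i) ^ (1 / p)) ^ p) ^ (1 / p) := by
        refine Real.rpow_le_rpow (Finset.sum_nonneg hwy) (Finset.sum_le_sum fun i hi => ?_) hr
        rw [← root (hwy i hi)]
        refine Real.rpow_le_rpow (Real.rpow_nonneg (hwy i hi) _) ?_ (by linarith)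
        rw [Real.mul_rpow (hw i hi) (hy i hi), Real.mul_rpow (hw i hi) (hx i hi)]
        linarith [mul_le_mul_of_nonneg_left (h i hi) (Real.rpow_nonneg (hw i hi) (1 / p))]
    _ ≤ (∑ i ∈ S, (a * w i ^ (1 / p)) ^ p) ^ (1 / p) +
          (∑ i ∈ S, (b * (w i * x i) ^ (1 / p)) ^ p) ^ (1 / p) :=
        Real.Lp_add_le_of_nonneg S hp
          (fun i hi => mul_nonneg ha (Real.rpow_nonneg (hw i hi) _))
          (fun i hi => mul_nonneg hb (Real.rpow_nonneg (hwx i hi) _))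
    _ = _ := by rw [scale ha hw, scale hb hwx]

/-- for `1 ≤ k ≤ n`, the map `A ↦ (σ_k(A⁻¹))^(1/k)` is convex on the set
of symmetric positive definite `n×n` real matrices; this is the structural condition
(1.7) for the Hessian operator `σ_k^(1/k)` on convex admissible solutions. -/
theorem stmt14 {n : ℕ} (hn : 1 ≤ n) (k : ℕ) (hk1 : 1 ≤ k) (hkn : k ≤ n) :
    ConvexOn ℝ {A : Matrix (Fin n) (Fin n) ℝ | A.PosDef}
      (fun A => sigmaE k A⁻¹ ^ ((1 : ℝ) / (k : ℝ))) := by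
  have hconv : ∀ {A B : Matrix (Fin n) (Fin n) ℝ}, A.PosDef → B.PosDef → ∀ {a b : ℝ},
      0 ≤ a → 0 ≤ b → a + b = 1 → (a • A + b • B).PosDef := by
    intro A B hA hB a b ha hb hab
    rcases ha.eq_or_lt with rfl | ha
    · obtain rfl : b = 1 := by linarith
      simpa using hB
    · exact (hA.smul ha).add_posSemidef (hB.posSemidef.smul hb)
  refine ⟨fun A hA B hB a b ha hb hab => hconv hA hB ha hb hab, ?_⟩
  intro A hA B hB a b ha hb hab
  obtain ⟨P, d, -, hd, rfl, rfl⟩ := Matrix.PosDef.exists_simultaneous_diagonalization hA hB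
  have hcard : k ≤ Fintype.card (Fin n) := by simpa using hkn
  have hpos : ∀ i, 0 < a + b * d i := fun i => by
    rcases ha.eq_or_lt with rfl | ha
    · obtain rfl : b = 1 := by linarith
      simpa using hd i
    · have := hd i
      positivity
  have hcomb : a • (P * Pᴴ) + b • (P * diagonal d * Pᴴ) =
      P * diagonal (fun i => a + b * d i) * Pᴴ := by
    have h : diagonal (fun i => a + b * d i) = a • (1 : Matrix (Fin n) (Fin n) ℝ) +
        b • diagonal d := by
      rw [smul_one_eq_diagonal, ← diagonal_smul, diagonal_add]
      rfl
    rw [h]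
    simp [Matrix.mul_add, Matrix.add_mul]
  have hone : P * Pᴴ = P * diagonal (fun _ => (1 : ℝ)) * Pᴴ := by simp
  have hG : (P⁻¹ * P⁻¹ᴴ).PosSemidef := posSemidef_self_mul_conjTranspose _
  simp only [smul_eq_mul]
  rw [hcomb, hone, sigmaE_inv_congruence k P fun i => (hpos i).ne',
    sigmaE_inv_congruence k P fun i => (hd i).ne',
    sigmaE_inv_congruence k P fun _ => one_ne_zero,
    sigmaE_diagonal_mul hcard, sigmaE_diagonal_mul hcard, sigmaE_diagonal_mul hcard]
  simp only [inv_one, Finset.prod_const_one, mul_one]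
  exact rpow_sum_le_of_rpow_le _ (by exact_mod_cast hk1) ha hb
    (fun s _ => (hG.submatrix _).det_nonneg)
    (fun s _ => Finset.prod_nonneg fun i _ => (inv_pos.mpr (hd i)).le)
    (fun s _ => Finset.prod_nonneg fun i _ => (inv_pos.mpr (hpos i)).le)
    (fun s _ => prod_inv_affine_rpow_le s hd ha hb hab (by positivity))
end

section
/- Fix integers n ≥ 1 and 0 < l < k ≤ n. The map A ↦ (σ_k(A⁻¹)/σ_l(A⁻¹))^{1/(k−l)} is convex on the set of symmetric positive definite n×n real matrices. Consequently, the Hessian quotient operator (σ_k/σ_l)^{1/(k−l)} satisfies the structural condition (1.7) for convex admissible solutions. -/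
open Matrix

/-- The `k`-th elementary symmetric function of the numbers `x i`, `i ∈ s`. -/
noncomputable def esymmOn {ι : Type*} (s : Finset ι) (k : ℕ) (x : ι → ℝ) : ℝ :=
  ∑ t ∈ s.powersetCard k, ∏ i ∈ t, x i

section esymmOn

variable {ι : Type*}

lemma esymmOn_pos {s : Finset ι} {k : ℕ} (hk : k ≤ s.card) {x : ι → ℝ} (hx : ∀ i, 0 < x i) :
    0 < esymmOn s k x :=
  Finset.sum_pos (fun _ _ => Finset.prod_pos fun i _ => hx i) (Finset.powersetCard_nonempty.2 hk)

lemma esymmOn_nonneg (s : Finset ι) (k : ℕ) {x : ι → ℝ} (hx : ∀ i, 0 < x i) :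
    0 ≤ esymmOn s k x :=
  Finset.sum_nonneg fun _ _ => Finset.prod_nonneg fun i _ => (hx i).le

@[simp] lemma esymmOn_zero (s : Finset ι) (x : ι → ℝ) : esymmOn s 0 x = 1 := by
  simp [esymmOn]

lemma esymmOn_smul (s : Finset ι) (k : ℕ) (c : ℝ) (x : ι → ℝ) :
    esymmOn s k (c • x) = c ^ k * esymmOn s k x := by
  rw [esymmOn, esymmOn, Finset.mul_sum]
  refine Finset.sum_congr rfl fun t ht => ?_
  simp [Finset.prod_mul_distrib, (Finset.mem_powersetCard.1 ht).2]

lemma esymmOn_univ_comp_perm [Fintype ι] (k : ℕ) (x : ι → ℝ) (σ : Equiv.Perm ι) :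
    esymmOn Finset.univ k (x ∘ σ) = esymmOn Finset.univ k x := by
  rw [esymmOn, esymmOn, ← Finset.esymm_map_val, ← Finset.esymm_map_val]
  congr 1
  rw [← Multiset.map_map, Multiset.map_univ_val_equiv]

lemma convex_pi_pos : Convex ℝ {x : ι → ℝ | ∀ i, 0 < x i} := by
  intro x hx y hy a b ha hb hab i
  exact (convex_Ioi (0 : ℝ)) (hx i) (hy i) ha hb hab

variable [DecidableEq ι]

lemma esymmOn_insert {s : Finset ι} {j : ι} (hj : j ∉ s) (k : ℕ) (x : ι → ℝ) :
    esymmOn (insert j s) (k + 1) x = x j * esymmOn s k x + esymmOn s (k + 1) x := by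
  have hmem : ∀ t ∈ s.powersetCard k, j ∉ t := fun t ht h =>
    hj ((Finset.mem_powersetCard.1 ht).1 h)
  rw [esymmOn, Finset.powersetCard_succ_insert hj, Finset.sum_union, Finset.sum_image, add_comm,
    esymmOn, esymmOn, Finset.mul_sum]
  · congr 1
    exact Finset.sum_congr rfl fun t ht => Finset.prod_insert (hmem t ht)
  · intro t ht u hu h
    have h' := congrArg (fun v => Finset.erase v j) h
    simpa [Finset.erase_insert (hmem t ht), Finset.erase_insert (hmem u hu)] using h'
  · refine Finset.disjoint_left.2 fun t ht ht' => ?_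
    obtain ⟨u, -, rfl⟩ := Finset.mem_image.1 ht'
    exact hj ((Finset.mem_powersetCard.1 ht).1 (Finset.mem_insert_self j u))

lemma esymmOn_succ_of_mem {s : Finset ι} {i : ι} (hi : i ∈ s) (k : ℕ) (x : ι → ℝ) :
    esymmOn s (k + 1) x = x i * esymmOn (s.erase i) k x + esymmOn (s.erase i) (k + 1) x := by
  conv_lhs => rw [← Finset.insert_erase hi]
  exact esymmOn_insert (Finset.notMem_erase i s) k x

/-- Euler's identity for elementary symmetric functions. -/
lemma sum_mul_esymmOn_erase (s : Finset ι) (k : ℕ) (x : ι → ℝ) :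
    ∑ i ∈ s, x i * esymmOn (s.erase i) k x = (k + 1) * esymmOn s (k + 1) x := by
  induction s using Finset.induction_on generalizing k with
  | empty =>
    rw [esymmOn, Finset.powersetCard_eq_empty.2 (by simp)]
    simp
  | insert j s hj ih =>
    have herase : ∀ i ∈ s, (insert j s).erase i = insert j (s.erase i) := fun i hi =>
      Finset.erase_insert_of_ne (by rintro rfl; exact hj hi)
    rw [Finset.sum_insert hj, Finset.erase_insert hj, esymmOn_insert hj]
    cases k with
    | zero =>
      have h := ih 0
      simp only [esymmOn_zero] at h ⊢
      rw [h]
      push_cast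
      ring
    | succ k =>
      have h : ∀ i ∈ s, x i * esymmOn ((insert j s).erase i) (k + 1) x =
          x j * (x i * esymmOn (s.erase i) k x) + x i * esymmOn (s.erase i) (k + 1) x := by
        intro i hi
        rw [herase i hi, esymmOn_insert (fun h => hj (Finset.mem_of_mem_erase h))]
        ring
      rw [Finset.sum_congr rfl h, Finset.sum_add_distrib, ← Finset.mul_sum, ih, ih]
      push_cast
      ring

/-- The quotient of consecutive elementary symmetric functions as a sum of parallel sums. -/
lemma esymmOn_quotient_succ {s : Finset ι} {k : ℕ} (hk : k + 1 ≤ s.card) {x : ι → ℝ}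
    (hx : ∀ i, 0 < x i) :
    (k + 2) * (esymmOn s (k + 2) x / esymmOn s (k + 1) x) =
      ∑ i ∈ s, x i * (esymmOn (s.erase i) (k + 1) x / esymmOn (s.erase i) k x) /
        (x i + esymmOn (s.erase i) (k + 1) x / esymmOn (s.erase i) k x) := by
  have hpos := esymmOn_pos hk hx
  have hEuler := sum_mul_esymmOn_erase s (k + 1) x
  push_cast at hEuler
  rw [← mul_div_assoc, show (k : ℝ) + 2 = k + 1 + 1 by ring, ← hEuler, Finset.sum_div]
  refine Finset.sum_congr rfl fun i hi => ?_
  have hcard : k ≤ (s.erase i).card := by rw [Finset.card_erase_of_mem hi]; omega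
  have hpos' := esymmOn_pos hcard hx
  rw [esymmOn_succ_of_mem hi] at hpos ⊢
  field_simp

/-- Superadditivity of the parallel sum, together with its monotonicity. -/
lemma parallelSum_add_le {a b r t R : ℝ} (ha : 0 < a) (hb : 0 < b) (hr : 0 ≤ r) (ht : 0 ≤ t)
    (hR : r + t ≤ R) :
    a * r / (a + r) + b * t / (b + t) ≤ (a + b) * R / (a + b + R) := by
  have hmono : (a + b) * (r + t) / (a + b + (r + t)) ≤ (a + b) * R / (a + b + R) := by
    rw [div_le_div_iff₀ (by positivity) (by linarith)]
    nlinarith [mul_nonneg (mul_pos (add_pos ha hb) (add_pos ha hb)).le (sub_nonneg.2 hR)]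
  refine le_trans ?_ hmono
  rw [div_add_div _ _ (by positivity) (by positivity), div_le_div_iff₀ (by positivity)
    (by positivity)]
  nlinarith [sq_nonneg (a * t - b * r)]

lemma esymmOn_quotient_add_le (k : ℕ) (s : Finset ι) (hk : k ≤ s.card) {x y : ι → ℝ}
    (hx : ∀ i, 0 < x i) (hy : ∀ i, 0 < y i) :
    esymmOn s (k + 1) x / esymmOn s k x + esymmOn s (k + 1) y / esymmOn s k y ≤
      esymmOn s (k + 1) (x + y) / esymmOn s k (x + y) := by
  have hxy : ∀ i, 0 < (x + y) i := fun i => add_pos (hx i) (hy i)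
  induction k generalizing s with
  | zero =>
    have h : ∀ z : ι → ℝ, esymmOn s 1 z = ∑ i ∈ s, z i := fun z => by
      simpa using (sum_mul_esymmOn_erase s 0 z).symm
    simp [h, Finset.sum_add_distrib]
  | succ k ih =>
    refine le_of_mul_le_mul_left ?_ (show (0 : ℝ) < k + 2 by positivity)
    rw [mul_add, esymmOn_quotient_succ hk hx, esymmOn_quotient_succ hk hy,
      esymmOn_quotient_succ hk hxy, ← Finset.sum_add_distrib]
    refine Finset.sum_le_sum fun i hi => ?_
    have hcard : k ≤ (s.erase i).card := by rw [Finset.card_erase_of_mem hi]; omega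
    exact parallelSum_add_le (hx i) (hy i)
      (div_nonneg (esymmOn_nonneg _ _ hx) (esymmOn_nonneg _ _ hx))
      (div_nonneg (esymmOn_nonneg _ _ hy) (esymmOn_nonneg _ _ hy)) (ih _ hcard)

/-- **Marcus–Lopes inequality**: quotients of consecutive elementary symmetric functions are
concave on the positive orthant. -/
lemma concaveOn_esymmOn_quotient (k : ℕ) (s : Finset ι) (hk : k ≤ s.card) :
    ConcaveOn ℝ {x : ι → ℝ | ∀ i, 0 < x i} (fun x => esymmOn s (k + 1) x / esymmOn s k x) := by
  refine concaveOn_iff_forall_pos.2 ⟨convex_pi_pos, fun x hx y hy a b ha hb _ => ?_⟩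
  have hhom : ∀ (c : ℝ), 0 < c → ∀ z : ι → ℝ,
      c • (esymmOn s (k + 1) z / esymmOn s k z) =
        esymmOn s (k + 1) (c • z) / esymmOn s k (c • z) := by
    intro c hc z
    rw [esymmOn_smul, esymmOn_smul, smul_eq_mul, pow_succ, mul_assoc,
      mul_div_mul_left _ _ (pow_pos hc k).ne', mul_div_assoc]
  simp only [hhom a ha, hhom b hb]
  exact esymmOn_quotient_add_le k s hk (fun i => mul_pos ha (hx i)) (fun i => mul_pos hb (hy i))

lemma convexOn_log_esymmOn_sub_log_esymmOn (s : Finset ι) {p q : ℕ} (hpq : p ≤ q)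
    (hq : q ≤ s.card) :
    ConvexOn ℝ {x : ι → ℝ | ∀ i, 0 < x i}
      (fun x => Real.log (esymmOn s p x) - Real.log (esymmOn s q x)) := by
  induction q, hpq using Nat.le_induction with
  | base => simpa using convexOn_const (0 : ℝ) convex_pi_pos
  | succ q hpq ih =>
    have hq' : q ≤ s.card := by omega
    have hconc : ConcaveOn ℝ {x : ι → ℝ | ∀ i, 0 < x i}
        (fun x => Real.log (esymmOn s (q + 1) x / esymmOn s q x)) := by
      refine ⟨convex_pi_pos, fun x hx y hy a b ha hb hab => ?_⟩
      have hquot : ∀ z : ι → ℝ, (∀ i, 0 < z i) → 0 < esymmOn s (q + 1) z / esymmOn s q z :=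
        fun z hz => div_pos (esymmOn_pos hq hz) (esymmOn_pos hq' hz)
      refine (strictConcaveOn_log_Ioi.concaveOn.2 (hquot x hx) (hquot y hy) ha hb hab).trans ?_
      exact Real.log_le_log (convex_Ioi (0 : ℝ) (hquot x hx) (hquot y hy) ha hb hab)
        ((concaveOn_esymmOn_quotient q s hq').2 hx hy ha hb hab)
    refine ((ih hq').sub hconc).congr fun x hx => ?_
    simp only [Pi.sub_apply]
    rw [Real.log_div (esymmOn_pos hq hx).ne' (esymmOn_pos hq' hx).ne']
    ring

lemma convexOn_esymmOn_quotient_rpow (s : Finset ι) {p q : ℕ} (hpq : p ≤ q)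
    (hq : q ≤ s.card) {c : ℝ} (hc : 0 ≤ c) :
    ConvexOn ℝ {x : ι → ℝ | ∀ i, 0 < x i}
      (fun x => (esymmOn s p x / esymmOn s q x) ^ c) := by
  have hlog := (convexOn_log_esymmOn_sub_log_esymmOn s hpq hq).smul hc
  have hexp : ConvexOn ℝ {x : ι → ℝ | ∀ i, 0 < x i} (fun x => Real.exp
      (c • (Real.log (esymmOn s p x) - Real.log (esymmOn s q x)))) := by
    refine ⟨convex_pi_pos, fun x hx y hy a b ha hb hab => ?_⟩
    exact (Real.exp_le_exp.2 (hlog.2 hx hy ha hb hab)).trans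
      (convexOn_exp.2 (Set.mem_univ _) (Set.mem_univ _) ha hb hab)
  refine hexp.congr fun x hx => ?_
  have hp' := esymmOn_pos (hpq.trans hq) hx
  have hq' := esymmOn_pos hq hx
  simp only
  rw [Real.rpow_def_of_pos (div_pos hp' hq'), Real.log_div hp'.ne' hq'.ne', smul_eq_mul, mul_comm]

variable [Fintype ι]

lemma esymmOn_univ_inv {k : ℕ} (hk : k ≤ Fintype.card ι) {x : ι → ℝ} (hx : ∀ i, 0 < x i) :
    esymmOn Finset.univ k x⁻¹ = esymmOn Finset.univ (Fintype.card ι - k) x / ∏ i, x i := by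
  rw [esymmOn, esymmOn, Finset.sum_div]
  refine Finset.sum_nbij' (fun t => tᶜ) (fun t => tᶜ) ?_ ?_ (by simp) (by simp) ?_
  · intro t ht
    simp_all [Finset.mem_powersetCard, Finset.card_compl]
  · intro t ht
    simp_all [Finset.mem_powersetCard, Finset.card_compl, Nat.sub_sub_self]
  · intro t _
    have ht : 0 < ∏ i ∈ t, x i := Finset.prod_pos fun i _ => hx i
    have htc : 0 < ∏ i ∈ tᶜ, x i := Finset.prod_pos fun i _ => hx i
    rw [← Finset.prod_mul_prod_compl t x]
    simp only [Pi.inv_apply, Finset.prod_inv_distrib]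
    field_simp

lemma sigmaE_conj_diagonal {k : ℕ} (hk : k ≤ Fintype.card ι)
    (U : Matrix.unitaryGroup ι ℝ) (x : ι → ℝ) :
    sigmaE k ((U : Matrix ι ι ℝ) * diagonal x * star (U : Matrix ι ι ℝ)) =
      esymmOn Finset.univ k x := by
  have hchar : ((U : Matrix ι ι ℝ) * diagonal x * star (U : Matrix ι ι ℝ)).charpoly =
      (diagonal x).charpoly := by
    rw [Matrix.charpoly_mul_comm, ← mul_assoc, Unitary.coe_star_mul_self, one_mul]
  have hcoeff := Multiset.prod_X_sub_C_coeff (Finset.univ.val.map x)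
    (k := Fintype.card ι - k) (by simp)
  rw [Multiset.map_map] at hcoeff
  rw [sigmaE, if_pos hk, hchar, Matrix.charpoly_diagonal, Finset.prod]
  refine (congrArg _ hcoeff).trans ?_
  simp only [Multiset.card_map, Finset.card_val, Finset.card_univ, Nat.sub_sub_self hk,
    Finset.esymm_map_val]
  rw [← mul_assoc, ← mul_pow]
  simp [esymmOn]

end esymmOn

section spectral

variable {ι : Type*} [Fintype ι] [DecidableEq ι]

lemma Matrix.PosDef.exists_unitary_conj_diagonal {A : Matrix ι ι ℝ} (hA : A.PosDef) :
    ∃ (U : Matrix.unitaryGroup ι ℝ) (x : ι → ℝ), (∀ i, 0 < x i) ∧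
      A = (U : Matrix ι ι ℝ) * diagonal x * star (U : Matrix ι ι ℝ) :=
  ⟨hA.1.eigenvectorUnitary, hA.1.eigenvalues, hA.eigenvalues_pos, by
    simpa [Unitary.conjStarAlgAut_apply, Function.comp_def] using hA.1.spectral_theorem⟩

lemma sq_entries_mem_doublyStochastic (V : Matrix.unitaryGroup ι ℝ) :
    Matrix.of (fun i j => (V : Matrix ι ι ℝ) i j ^ 2) ∈ doublyStochastic ℝ ι := by
  rw [mem_doublyStochastic_iff_sum]
  refine ⟨fun i j => sq_nonneg _, fun i => ?_, fun j => ?_⟩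
  · have h := congrFun (congrFun (Unitary.coe_mul_star_self V) i) i
    simpa [Matrix.mul_apply, Matrix.star_apply, sq] using h
  · have h := congrFun (congrFun (Unitary.coe_star_mul_self V) j) j
    simpa [Matrix.mul_apply, Matrix.star_apply, sq] using h

lemma diag_conj_diagonal (V : Matrix ι ι ℝ) (x : ι → ℝ) :
    diag (V * diagonal x * star V) = Matrix.of (fun i j => V i j ^ 2) *ᵥ x := by
  ext i
  rw [diag_apply, Matrix.mul_apply]
  simp only [Matrix.mul_diagonal, Matrix.star_apply, star_trivial, mulVec, dotProduct,
    Matrix.of_apply]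
  exact Finset.sum_congr rfl fun j _ => by ring

/-- A symmetric convex function decreases when passing from the eigenvalues of a positive
definite matrix to its diagonal. -/
lemma ConvexOn.map_diag_conj_diagonal_le {φ : (ι → ℝ) → ℝ}
    (hφ : ConvexOn ℝ {x : ι → ℝ | ∀ i, 0 < x i} φ)
    (hsymm : ∀ (x : ι → ℝ) (σ : Equiv.Perm ι), φ (x ∘ σ) = φ x)
    (V : Matrix.unitaryGroup ι ℝ) {x : ι → ℝ} (hx : ∀ i, 0 < x i) :
    φ (diag ((V : Matrix ι ι ℝ) * diagonal x * star (V : Matrix ι ι ℝ))) ≤ φ x := by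
  obtain ⟨w, hw, hw1, hsum⟩ :=
    exists_eq_sum_perm_of_mem_doublyStochastic (sq_entries_mem_doublyStochastic V)
  have hdiag : diag ((V : Matrix ι ι ℝ) * diagonal x * star (V : Matrix ι ι ℝ)) =
      ∑ σ, w σ • (x ∘ σ) := by
    rw [diag_conj_diagonal, ← hsum, Matrix.sum_mulVec]
    simp only [Matrix.smul_mulVec, Matrix.permMatrix_mulVec]
  rw [hdiag]
  refine (hφ.map_sum_le (p := fun σ : Equiv.Perm ι => x ∘ σ) (fun σ _ => hw σ) hw1
    fun σ _ i => hx (σ i)).trans ?_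
  simp only [hsymm, ← Finset.sum_smul, hw1, one_smul, le_refl]

/-- **Davis' theorem** on positive definite matrices: a convex symmetric function of the
eigenvalues is a convex function of the matrix. -/
theorem convexOn_posDef_of_spectral {φ : (ι → ℝ) → ℝ} {F : Matrix ι ι ℝ → ℝ}
    (hφ : ConvexOn ℝ {x : ι → ℝ | ∀ i, 0 < x i} φ)
    (hsymm : ∀ (x : ι → ℝ) (σ : Equiv.Perm ι), φ (x ∘ σ) = φ x)
    (hF : ∀ (U : Matrix.unitaryGroup ι ℝ) (x : ι → ℝ), (∀ i, 0 < x i) →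
      F ((U : Matrix ι ι ℝ) * diagonal x * star (U : Matrix ι ι ℝ)) = φ x) :
    ConvexOn ℝ {A : Matrix ι ι ℝ | A.PosDef} F := by
  have hconv : ∀ ⦃A : Matrix ι ι ℝ⦄, A.PosDef → ∀ ⦃B : Matrix ι ι ℝ⦄, B.PosDef →
      ∀ ⦃a b : ℝ⦄, 0 < a → 0 < b → (a • A + b • B).PosDef := fun A hA B hB a b ha hb =>
    (hA.smul ha).add (hB.smul hb)
  refine convexOn_iff_forall_pos.2
    ⟨convex_iff_forall_pos.2 fun A hA B hB a b ha hb _ => hconv hA hB ha hb,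
      fun A hA B hB a b ha hb hab => ?_⟩
  obtain ⟨U, z, hz, hC⟩ := (hconv hA hB ha hb).exists_unitary_conj_diagonal
  have hdiag : ∀ M : Matrix ι ι ℝ, M.PosDef →
      (∀ i, 0 < diag (star (U : Matrix ι ι ℝ) * M * (U : Matrix ι ι ℝ)) i) ∧
      φ (diag (star (U : Matrix ι ι ℝ) * M * (U : Matrix ι ι ℝ))) ≤ F M := by
    intro M hM
    constructor
    · intro i
      have hpos : (star (U : Matrix ι ι ℝ) * M * (U : Matrix ι ι ℝ)).PosDef :=
        (Matrix.IsUnit.posDef_star_left_conjugate_iff (Unitary.toUnits U).isUnit).2 hM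
      exact hpos.diag_pos
    · obtain ⟨W, x, hx, rfl⟩ := hM.exists_unitary_conj_diagonal
      rw [hF W x hx]
      convert hφ.map_diag_conj_diagonal_le hsymm (star U * W) hx using 3
      simp [mul_assoc]
  have hz' : z = a • diag (star (U : Matrix ι ι ℝ) * A * (U : Matrix ι ι ℝ)) +
      b • diag (star (U : Matrix ι ι ℝ) * B * (U : Matrix ι ι ℝ)) := by
    have h : star (U : Matrix ι ι ℝ) * (a • A + b • B) * (U : Matrix ι ι ℝ) = diagonal z := by
      rw [hC, ← mul_assoc, ← mul_assoc, Unitary.coe_star_mul_self, one_mul, mul_assoc,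
        Unitary.coe_star_mul_self, mul_one]
    rw [← Matrix.diag_diagonal z, ← h]
    simp [mul_add, add_mul]
  rw [hC, hF U z hz, hz']
  refine (hφ.2 (hdiag A hA).1 (hdiag B hB).1 ha.le hb.le hab).trans ?_
  exact add_le_add (smul_le_smul_of_nonneg_left (hdiag A hA).2 ha.le)
    (smul_le_smul_of_nonneg_left (hdiag B hB).2 hb.le)

lemma inv_conj_diagonal (U : Matrix.unitaryGroup ι ℝ) {x : ι → ℝ} (hx : ∀ i, 0 < x i) :
    ((U : Matrix ι ι ℝ) * diagonal x * star (U : Matrix ι ι ℝ))⁻¹ =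
      (U : Matrix ι ι ℝ) * diagonal x⁻¹ * star (U : Matrix ι ι ℝ) := by
  refine Matrix.inv_eq_right_inv ?_
  have hd : diagonal x * diagonal x⁻¹ = (1 : Matrix ι ι ℝ) := by
    rw [Matrix.diagonal_mul_diagonal, ← Matrix.diagonal_one]
    exact congrArg _ (funext fun i => mul_inv_cancel₀ (hx i).ne')
  calc (U : Matrix ι ι ℝ) * diagonal x * star (U : Matrix ι ι ℝ) *
        ((U : Matrix ι ι ℝ) * diagonal x⁻¹ * star (U : Matrix ι ι ℝ))
      = (U : Matrix ι ι ℝ) * (diagonal x * (star (U : Matrix ι ι ℝ) * U) * diagonal x⁻¹) *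
        star (U : Matrix ι ι ℝ) := by simp only [mul_assoc]
    _ = 1 := by
      rw [Unitary.coe_star_mul_self, mul_one, hd, mul_one]
      exact Unitary.mul_star_self_of_mem U.2

end spectral

/-- for `0 < l < k ≤ n`, the map `A ↦ (σ_k(A⁻¹)/σ_l(A⁻¹))^(1/(k−l))` is
convex on the set of symmetric positive definite `n×n` real matrices; this is the
structural condition (1.7) for the Hessian quotient operator `(σ_k/σ_l)^(1/(k−l))` on
convex admissible solutions. -/
theorem stmt15 {n : ℕ} (hn : 1 ≤ n) (k l : ℕ) (hl : 0 < l) (hlk : l < k) (hkn : k ≤ n) :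
    ConvexOn ℝ {A : Matrix (Fin n) (Fin n) ℝ | A.PosDef}
      (fun A => (sigmaE k A⁻¹ / sigmaE l A⁻¹) ^ ((1 : ℝ) / ((k : ℝ) - (l : ℝ)))) := by
  have hc : (0 : ℝ) ≤ 1 / ((k : ℝ) - (l : ℝ)) :=
    one_div_nonneg.2 (sub_nonneg.2 (Nat.cast_le.2 hlk.le))
  refine convexOn_posDef_of_spectral
    (convexOn_esymmOn_quotient_rpow Finset.univ (p := n - k) (q := n - l) (by omega)
      (by simp) hc) (fun x σ => ?_) (fun U x hx => ?_)
  · simp only [esymmOn_univ_comp_perm]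
  · have hk : k ≤ Fintype.card (Fin n) := by simpa using hkn
    have hl' : l ≤ Fintype.card (Fin n) := hlk.le.trans hk
    have hprod : 0 < ∏ i, x i := Finset.prod_pos fun i _ => hx i
    simp only [inv_conj_diagonal U hx]
    rw [sigmaE_conj_diagonal hk, sigmaE_conj_diagonal hl', esymmOn_univ_inv hk hx,
      esymmOn_univ_inv hl' hx, div_div_div_cancel_right₀ hprod.ne', Fintype.card_fin]
end
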